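/- arXiv:1309.2567 — 2 statements merged into one kernel-verified Lean document; each statement's English description precedes it below -/
import Mathlib

section
/- (Laurent Phenomenon) For every k ∈ ℤ the generalized cluster algebra A(P1,P2) is contained in T_k; in particular every cluster variable x_m (m ∈ ℤ) is a Laurent polynomial in x_k and x_{k+1} with coefficients in the ring underline-K. -/
open Polynomial
noncomputable section

namespace GCA

/-- The ambient field of rational functions in two variables over `K`. -/
abbrev F (K : Type*) [Field K] := FractionRing (MvPolynomial (Fin 2) K)

/-- The canonical embedding of `K` into `F K`. -/
def φ (K : Type*) [Field K] : K →+* F K :=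
  (algebraMap (MvPolynomial (Fin 2) K) (F K)).comp (MvPolynomial.C)

/-- The two variables `x1, x2` in `F K`. -/
def Xv (K : Type*) [Field K] (i : Fin 2) : F K :=
  algebraMap (MvPolynomial (Fin 2) K) (F K) (MvPolynomial.X i)

/-- A polynomial of degree `d` is palindromic if `P(z) = z^d P(1/z)`. -/
def Palindromic {K : Type*} [Field K] (P : K[X]) : Prop :=
  ∀ t ≤ P.natDegree, P.coeff t = P.coeff (P.natDegree - t)

/-- `x : ℤ → F K` is the sequence of cluster variables for the exchange
polynomials `P1, P2`. -/
def ClusterSeq {K : Type*} [Field K] (P1 P2 : K[X]) (x : ℤ → F K) : Prop :=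
  x 1 = Xv K 0 ∧ x 2 = Xv K 1 ∧ (∀ k, x k ≠ 0) ∧
    ∀ k : ℤ, x (k + 1) * x (k - 1) =
      if Even k then Polynomial.eval₂ (φ K) (x k) P1 else Polynomial.eval₂ (φ K) (x k) P2

/-- `underline-K`: the ℤ-subalgebra (subring) of `K` generated by the coefficients
of `P1` and `P2`. -/
def uK {K : Type*} [Field K] (P1 P2 : K[X]) : Subring K :=
  Subring.closure (Set.range P1.coeff ∪ Set.range P2.coeff)

/-- The generalized cluster algebra `A(P1,P2)`: the `uK`-subalgebra of `F K`
generated by the cluster variables, as a subring of `F K`. -/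
def clA {K : Type*} [Field K] (P1 P2 : K[X]) (x : ℤ → F K) : Subring (F K) :=
  Subring.closure (φ K '' (uK P1 P2 : Set K) ∪ Set.range x)

/-- The Laurent polynomial ring `T k` in the cluster `{x k, x (k+1)}`. -/
def clT {K : Type*} [Field K] (P1 P2 : K[X]) (x : ℤ → F K) (k : ℤ) : Subring (F K) :=
  Subring.closure (φ K '' (uK P1 P2 : Set K) ∪ {x k, (x k)⁻¹, x (k + 1), (x (k + 1))⁻¹})

/-- The standard monomial `z_k[a1,a2]`. -/
def zmon {K : Type*} [Field K] (x : ℤ → F K) (k a1 a2 : ℤ) : F K :=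
  x (k - 1) ^ (max a2 0).toNat * x k ^ (max (-a1) 0).toNat *
    x (k + 1) ^ (max (-a2) 0).toNat * x (k + 2) ^ (max a1 0).toNat

/-- `y` is pointed at `(a1, a2)` with coefficient function `c`. -/
def PointedAt {K : Type*} [Field K] (P1 P2 : K[X]) (x : ℤ → F K) (a1 a2 : ℤ)
    (c : ℕ × ℕ →₀ K) (y : F K) : Prop :=
  (∀ m, c m ∈ uK P1 P2) ∧ c (0, 0) = 1 ∧
    y = x 1 ^ (-a1) * x 2 ^ (-a2) *
      ∑ m ∈ c.support, φ K (c m) * x 1 ^ m.1 * x 2 ^ m.2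
/-- If `b * d ≡ 1` and `P(b) ≡ 0` modulo `c`, and the coefficients of `P` are symmetric,
then `P(d) ≡ 0` modulo `c`. -/
theorem dvd_eval_of_symm_coeff {S : Type*} [CommRing S] (P : S[X]) (n : ℕ)
    (hn : P.natDegree ≤ n) (hP : ∀ t ≤ n, P.coeff t = P.coeff (n - t)) {b c d : S}
    (hb : c ∣ P.eval b) (hbd : c ∣ b * d - 1) : c ∣ P.eval d := by
  rw [← Ideal.mem_span_singleton, ← Ideal.Quotient.eq_zero_iff_mem] at hb hbd ⊢
  set f := Ideal.Quotient.mk (Ideal.span {c})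
  have h1 : f b * f d = 1 := by
    rw [map_sub, map_mul, map_one] at hbd
    exact sub_eq_zero.mp hbd
  have h2 : f (P.eval d) = f d ^ n * f (P.eval b) := by
    rw [eval_eq_sum_range' (Nat.lt_succ_of_le hn), eval_eq_sum_range' (Nat.lt_succ_of_le hn),
      ← Finset.sum_range_reflect, map_sum, map_sum, Finset.mul_sum]
    refine Finset.sum_congr rfl fun i hi => ?_
    have hi : i ≤ n := Nat.lt_succ_iff.mp (Finset.mem_range.mp hi)
    have h3 : f d ^ n = f d ^ (n - i) * f d ^ i := by rw [← pow_add, Nat.sub_add_cancel hi]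
    have h4 : f b ^ i * f d ^ i = 1 := by rw [← mul_pow, h1, one_pow]
    rw [Nat.succ_sub_one, ← hP i hi, map_mul, map_mul, map_pow, map_pow, h3]
    linear_combination (-f (P.coeff i) * f d ^ (n - i)) * h4
  rw [h2, hb, mul_zero]

/-- One mutation step: if four consecutive cluster variables `a, b, c, d` lie in a subring
containing the coefficients, then so does the next one. -/
theorem mem_of_exchange {K L : Type*} [Field K] [Field L] (φ : K →+* L) (S : Subring L)
    {P Q : K[X]} (hPS : ∀ i, φ (P.coeff i) ∈ S) (hQS : ∀ i, φ (Q.coeff i) ∈ S)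
    (hP : Palindromic P) (hQ : Q.coeff 0 = 1) {a b c d e : L}
    (ha : a ∈ S) (hb : b ∈ S) (hc : c ∈ S) (hd : d ∈ S) (hc0 : c ≠ 0)
    (hac : c * a = P.eval₂ φ b) (hbd : b * d = Q.eval₂ φ c) (hce : c * e = P.eval₂ φ d) :
    e ∈ S := by
  have lift : ∀ R : K[X], (∀ i, φ (R.coeff i) ∈ S) →
      ∃ R' : S[X], R'.map S.subtype = R.map φ := fun R hR => by
    have : R.map φ ∈ lifts S.subtype :=
      (lifts_iff_coeff_lifts _).mpr fun i => ⟨⟨_, hR i⟩, (coeff_map φ i).symm⟩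
    exact (mem_lifts _).mp this
  have hinj : Function.Injective S.subtype := Subtype.val_injective
  obtain ⟨P', hP'⟩ := lift P hPS
  obtain ⟨Q', hQ'⟩ := lift Q hQS
  have eval_coe : ∀ {R : K[X]} {R' : S[X]}, R'.map S.subtype = R.map φ → ∀ s : S,
      ((R'.eval s : S) : L) = R.eval₂ φ s := fun {R R'} h s => by
    rw [← eval_map, ← h]
    exact (eval_map_apply (f := S.subtype) (p := R') s).symm
  have coeff_coe : ∀ {R : K[X]} {R' : S[X]}, R'.map S.subtype = R.map φ → ∀ i,
      S.subtype (R'.coeff i) = φ (R.coeff i) := fun {R R'} h i => by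
    rw [← coeff_map, h, coeff_map]
  have hdvd : (⟨c, hc⟩ : S) ∣ P'.eval ⟨d, hd⟩ := by
    refine dvd_eval_of_symm_coeff P' P.natDegree ?_ ?_ (b := ⟨b, hb⟩) ?_ ?_
    · rw [← natDegree_map_eq_of_injective hinj, hP', natDegree_map]
    · intro t ht
      apply hinj
      rw [coeff_coe hP', coeff_coe hP', hP t ht]
    · refine ⟨⟨a, ha⟩, Subtype.ext ?_⟩
      rw [eval_coe hP']
      exact hac.symm
    · have h0 : Q'.coeff 0 = 1 := hinj (by rw [coeff_coe hQ', hQ, map_one, map_one])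
      have hbd' : (⟨b, hb⟩ * ⟨d, hd⟩ : S) = Q'.eval ⟨c, hc⟩ := Subtype.ext <| by
        rw [eval_coe hQ']
        exact hbd
      have h1 := sub_dvd_eval_sub (⟨c, hc⟩ : S) 0 Q'
      rwa [sub_zero, ← coeff_zero_eq_eval_zero, h0, ← hbd'] at h1
  obtain ⟨s, hs⟩ := hdvd
  have hs' : c * e = c * s := by
    rw [hce, ← eval_coe hP' ⟨d, hd⟩, hs]
    rfl
  rw [mul_left_cancel₀ hc0 hs']
  exact s.2

theorem Palindromic.coeff_zero {K : Type*} [Field K] {P : K[X]} (hP : Palindromic P)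
    (hm : P.Monic) : P.coeff 0 = 1 := by
  rw [hP 0 (Nat.zero_le _), Nat.sub_zero]
  exact hm

/-- A subring containing the coefficients and four consecutive cluster variables contains all
cluster variables. -/
theorem ClusterSeq.mem_of_four_mem {K : Type*} [Field K] {P1 P2 : K[X]}
    (hm1 : P1.Monic) (hm2 : P2.Monic) (hp1 : Palindromic P1) (hp2 : Palindromic P2)
    {x : ℤ → F K} (hx : ClusterSeq P1 P2 x) (S : Subring (F K))
    (hS : ∀ r ∈ uK P1 P2, φ K r ∈ S) (k : ℤ) (ha : x (k - 1) ∈ S) (hb : x k ∈ S)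
    (hc : x (k + 1) ∈ S) (hd : x (k + 2) ∈ S) (m : ℤ) : x m ∈ S := by
  obtain ⟨-, -, hne, hex⟩ := hx
  have h1 : ∀ i, φ K (P1.coeff i) ∈ S := fun i =>
    hS _ (Subring.subset_closure (Or.inl ⟨i, rfl⟩))
  have h2 : ∀ i, φ K (P2.coeff i) ∈ S := fun i =>
    hS _ (Subring.subset_closure (Or.inr ⟨i, rfl⟩))
  obtain ⟨P, hPdef⟩ : ∃ P : ℤ → K[X], P = fun j => if Even j then P1 else P2 := ⟨_, rfl⟩
  have hP : ∀ j, (∀ i, φ K ((P j).coeff i) ∈ S) ∧ Palindromic (P j) ∧ (P j).coeff 0 = 1 := by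
    intro j
    rw [hPdef]
    dsimp only
    split_ifs
    · exact ⟨h1, hp1, hp1.coeff_zero hm1⟩
    · exact ⟨h2, hp2, hp2.coeff_zero hm2⟩
  have hP2 : ∀ j, P (j + 2) = P j := fun j => by simp [hPdef]
  have hex' : ∀ j, x (j + 1) * x (j - 1) = (P j).eval₂ (φ K) (x j) := fun j => by
    rw [hex, hPdef]
    dsimp only
    split_ifs <;> rfl
  have main : ∀ j : ℤ, x (j - 1) ∈ S ∧ x j ∈ S ∧ x (j + 1) ∈ S ∧ x (j + 2) ∈ S := by
    intro j
    induction j using Int.inductionOn' (b := k) with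
    | zero => exact ⟨ha, hb, hc, hd⟩
    | succ j _ ih =>
      obtain ⟨ha, hb, hc, hd⟩ := ih
      have e1 := hex' j
      have e2 := hex' (j + 1)
      have e3 := hex' (j + 2)
      rw [hP2] at e3
      ring_nf at ha hc hd e1 e2 e3 ⊢
      refine ⟨hb, hc, hd, ?_⟩
      exact mem_of_exchange (φ K) S (hP j).1 (hP (1 + j)).1 (hP j).2.1 (hP (1 + j)).2.2
        ha hb hc hd (hne _) e1 (by rw [mul_comm, e2]) e3
    | pred j _ ih =>
      obtain ⟨ha, hb, hc, hd⟩ := ih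
      have e1 := hex' (j + 1)
      have e2 := hex' j
      have e3 := hex' (j - 1)
      rw [← hP2] at e3
      ring_nf at ha hc hd e1 e2 e3 ⊢
      refine ⟨?_, ha, hb, hc⟩
      exact mem_of_exchange (φ K) S (hP (1 + j)).1 (hP j).1 (hP (1 + j)).2.1 (hP j).2.2
        hd hc hb ha (hne _) (by rw [mul_comm, e1]) e2 e3
  exact (main m).2.1

/-- **Laurent Phenomenon.**  The generalized cluster algebra `A(P1,P2)` is contained in
every Laurent ring `T k`; in particular every cluster variable `x m` is a Laurent
polynomial in `x k, x (k+1)` with coefficients in `underline-K`. -/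
theorem laurent_phenomenon {K : Type*} [Field K] [CharZero K] (P1 P2 : K[X])
    (hm1 : P1.Monic) (hm2 : P2.Monic) (hp1 : Palindromic P1) (hp2 : Palindromic P2)
    (x : ℤ → F K) (hx : ClusterSeq P1 P2 x) :
    ∀ k : ℤ, clA P1 P2 x ≤ clT P1 P2 x k ∧ ∀ m : ℤ, x m ∈ clT P1 P2 x k := by
  intro k
  have hcoeff : ∀ r ∈ uK P1 P2, φ K r ∈ clT P1 P2 x k := fun r hr =>
    Subring.subset_closure (Or.inl ⟨r, hr, rfl⟩)
  have hx0 : x k ∈ clT P1 P2 x k := Subring.subset_closure (by simp)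
  have hx0' : (x k)⁻¹ ∈ clT P1 P2 x k := Subring.subset_closure (by simp)
  have hx1 : x (k + 1) ∈ clT P1 P2 x k := Subring.subset_closure (by simp)
  have hx1' : (x (k + 1))⁻¹ ∈ clT P1 P2 x k := Subring.subset_closure (by simp)
  have hrhs : ∀ j, x j ∈ clT P1 P2 x k → x (j + 1) * x (j - 1) ∈ clT P1 P2 x k := by
    intro j hj
    rw [hx.2.2.2]
    have eval_mem : ∀ P : K[X], (∀ i, P.coeff i ∈ uK P1 P2) →
        P.eval₂ (φ K) (x j) ∈ clT P1 P2 x k := fun P hP => by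
      rw [eval₂_eq_sum_range]
      exact sum_mem fun i _ => mul_mem (hcoeff _ (hP i)) (pow_mem hj i)
    split_ifs
    · exact eval_mem P1 fun i => Subring.subset_closure (Or.inl ⟨i, rfl⟩)
    · exact eval_mem P2 fun i => Subring.subset_closure (Or.inr ⟨i, rfl⟩)
  have hprev : x (k - 1) ∈ clT P1 P2 x k := by
    have h := mul_mem hx1' (hrhs k hx0)
    rwa [inv_mul_cancel_left₀ (hx.2.2.1 _)] at h
  have hnext : x (k + 2) ∈ clT P1 P2 x k := by
    have h := mul_mem (hrhs (k + 1) hx1) hx0'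
    rwa [add_sub_cancel_right, mul_inv_cancel_right₀ (hx.2.2.1 _), add_assoc] at h
  have hmem : ∀ m, x m ∈ clT P1 P2 x k :=
    hx.mem_of_four_mem hm1 hm2 hp1 hp2 _ hcoeff k hprev hx0 hx1 hnext
  refine ⟨Subring.closure_le.mpr ?_, hmem⟩
  rintro _ (⟨r, hr, rfl⟩ | ⟨m, rfl⟩)
  exacts [hcoeff r hr, hmem m]

end GCA
end
end

section
/- (a) Let S1 be a horizontal grading on the maximal Dyck path D_{a1,a2}. For any horizontal edges h, h' ∈ D1, the local shadows sh(h;S1) and sh(h';S1) are either disjoint or one is contained in the other. (b) Let S2 be a vertical grading. For any vertical edges v, v' ∈ D2, the local shadows sh(v;S2) and sh(v';S2) are either disjoint or one is contained in the other. -/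
open scoped Classical
noncomputable section

namespace Dyck

/-- The edges of the maximal Dyck path `D_{a,b}`: `a` horizontal edges
`h_1, …, h_a` (0-indexed here) and `b` vertical edges `v_1, …, v_b`. -/
abbrev Edge (a b : ℕ) := Fin a ⊕ Fin b

/-- The height of the horizontal edge `h_{j+1}` of `D_{a,b}` is `⌊j·b/a⌋`. -/
def ht (a b : ℕ) (j : Fin a) : ℕ := j.1 * b / a

/-- The depth of the vertical edge `v_{j+1}` of `D_{a,b}` is `⌈(j+1)·a/b⌉`. -/
def dep (a b : ℕ) (j : Fin b) : ℕ := ((j.1 + 1) * a + b - 1) / b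

/-- The position (0-indexed) of an edge along the maximal Dyck path `D_{a,b}`:
a horizontal edge `h_{j+1}` is preceded by `j` horizontal edges and by `ht j`
vertical edges; a vertical edge `v_{j+1}` is preceded by `j` vertical edges and
by `dep j` horizontal edges. -/
def pos (a b : ℕ) : Edge a b → ℕ
  | Sum.inl j => j.1 + ht a b j
  | Sum.inr j => j.1 + dep a b j

/-- Cyclic distance from `e` to `f` along the closed loop `D_{a,b}`
(the endpoints `(0,0)` and `(a,b)` are identified). -/
def dd (a b : ℕ) (e f : Edge a b) : ℕ := (pos a b f + (a + b) - pos a b e) % (a + b)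

/-- The (cyclic) subpath of `D_{a,b}` from `e` to `f`, both included. -/
def subpath (a b : ℕ) (e f : Edge a b) : Finset (Edge a b) :=
  Finset.univ.filter fun g => dd a b e g ≤ dd a b e f

/-- The number of horizontal edges in a set of edges. -/
def hcount (a b : ℕ) (s : Finset (Edge a b)) : ℕ := (s.filter fun e => e.isLeft = true).card

/-- The number of vertical edges in a set of edges. -/
def vcount (a b : ℕ) (s : Finset (Edge a b)) : ℕ := (s.filter fun e => e.isRight = true).card

/-- The sum of a horizontal grading over the horizontal edges of a set of edges. -/
def hsum (a b : ℕ) (S1 : Fin a → ℕ) (s : Finset (Edge a b)) : ℕ :=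
  ∑ e ∈ s, Sum.elim S1 (fun _ => 0) e

/-- The sum of a vertical grading over the vertical edges of a set of edges. -/
def vsum (a b : ℕ) (S2 : Fin b → ℕ) (s : Finset (Edge a b)) : ℕ :=
  ∑ e ∈ s, Sum.elim (fun _ => 0) S2 e

/-- The horizontal shadow statistic `f_{S1}` of a set of edges. -/
def fH (a b : ℕ) (S1 : Fin a → ℕ) (s : Finset (Edge a b)) : ℤ :=
  (hsum a b S1 s : ℤ) - (vcount a b s : ℤ)

/-- The vertical shadow statistic `f_{S2}` of a set of edges. -/
def fV (a b : ℕ) (S2 : Fin b → ℕ) (s : Finset (Edge a b)) : ℤ :=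
  (vsum a b S2 s : ℤ) - (hcount a b s : ℤ)

/-- Horizontal grading condition (HGC) for the pair `(h, v)`: there is an edge `e`
with `he` a proper subpath of `hv` and `|(he)_2| = Σ_{h' ∈ (he)_1} S1(h')`. -/
def HGC (a b : ℕ) (S1 : Fin a → ℕ) (h : Fin a) (v : Fin b) : Prop :=
  ∃ e : Edge a b, dd a b (.inl h) e < dd a b (.inl h) (.inr v) ∧
    vcount a b (subpath a b (.inl h) e) = hsum a b S1 (subpath a b (.inl h) e)

/-- Vertical grading condition (VGC) for the pair `(h, v)`: there is an edge `e`
with `ev` a proper subpath of `hv` and `|(ev)_1| = Σ_{v' ∈ (ev)_2} S2(v')`. -/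
def VGC (a b : ℕ) (S2 : Fin b → ℕ) (h : Fin a) (v : Fin b) : Prop :=
  ∃ e : Edge a b, 0 < dd a b (.inl h) e ∧ dd a b (.inl h) e ≤ dd a b (.inl h) (.inr v) ∧
    hcount a b (subpath a b e (.inr v)) = vsum a b S2 (subpath a b e (.inr v))

/-- A pair of gradings `(S1, S2)` on `D_{a,b}` is compatible. -/
def Compatible (a b : ℕ) (S1 : Fin a → ℕ) (S2 : Fin b → ℕ) : Prop :=
  ∀ (h : Fin a) (v : Fin b), HGC a b S1 h v ∨ VGC a b S2 h v

/-- `e` is a "balanced" endpoint for the horizontal edge `h`: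
`|(he)_2| = Σ_{h' ∈ (he)_1} S1(h')`. -/
def balH (a b : ℕ) (S1 : Fin a → ℕ) (h : Fin a) (e : Edge a b) : Prop :=
  vcount a b (subpath a b (.inl h) e) = hsum a b S1 (subpath a b (.inl h) e)

/-- The local shadow `sh(h; S1)`: the vertical edges of the shortest balanced
subpath starting at `h` (all of `D2` if there is none). -/
def shH (a b : ℕ) (S1 : Fin a → ℕ) (h : Fin a) : Finset (Fin b) :=
  Finset.univ.filter fun v =>
    ∀ e : Edge a b, balH a b S1 h e → dd a b (.inl h) (.inr v) ≤ dd a b (.inl h) e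

/-- The shadow `sh(S1) = ⋃_h sh(h; S1)`. -/
def shadowH (a b : ℕ) (S1 : Fin a → ℕ) : Finset (Fin b) :=
  Finset.univ.filter fun v => ∃ h : Fin a, v ∈ shH a b S1 h

/-- The vertical edges removed from `sh(S1)` to form the remote shadow: for each
`d ∈ [1,a]`, the (up to) `S1(h_d)` vertical edges of depth `d` immediately
following `h_d`. -/
def removedH (a b : ℕ) (S1 : Fin a → ℕ) : Finset (Fin b) :=
  Finset.univ.filter fun v => ∃ hd : Fin a, hd.1 + 1 = dep a b v ∧
    (Finset.univ.filter fun v' : Fin b => dep a b v' = dep a b v ∧ v'.1 < v.1).card < S1 hd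

/-- The remote shadow `rsh(S1)`. -/
def rshH (a b : ℕ) (S1 : Fin a → ℕ) : Finset (Fin b) :=
  shadowH a b S1 \ removedH a b S1

/-- `e` is a "balanced" starting point for the vertical edge `v`:
`|(ev)_1| = Σ_{v' ∈ (ev)_2} S2(v')`. -/
def balV (a b : ℕ) (S2 : Fin b → ℕ) (e : Edge a b) (v : Fin b) : Prop :=
  hcount a b (subpath a b e (.inr v)) = vsum a b S2 (subpath a b e (.inr v))

/-- The local shadow `sh(v; S2)`: the horizontal edges of the shortest balanced
subpath ending at `v` (all of `D1` if there is none). -/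
def shV (a b : ℕ) (S2 : Fin b → ℕ) (v : Fin b) : Finset (Fin a) :=
  Finset.univ.filter fun h =>
    ∀ e : Edge a b, balV a b S2 e v → dd a b (.inl h) (.inr v) ≤ dd a b e (.inr v)

/-- The shadow `sh(S2) = ⋃_v sh(v; S2)`. -/
def shadowV (a b : ℕ) (S2 : Fin b → ℕ) : Finset (Fin a) :=
  Finset.univ.filter fun h => ∃ v : Fin b, h ∈ shV a b S2 v

/-- The horizontal edges removed from `sh(S2)` to form the remote shadow: for each
`ℓ ∈ [1,b]`, the (up to) `S2(v_ℓ)` horizontal edges of height `ℓ−1` immediately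
preceding `v_ℓ`. -/
def removedV (a b : ℕ) (S2 : Fin b → ℕ) : Finset (Fin a) :=
  Finset.univ.filter fun h => ∃ vl : Fin b, vl.1 = ht a b h ∧
    (Finset.univ.filter fun h' : Fin a => ht a b h' = ht a b h ∧ h.1 < h'.1).card < S2 vl

/-- The remote shadow `rsh(S2)`. -/
def rshV (a b : ℕ) (S2 : Fin b → ℕ) : Finset (Fin a) :=
  shadowV a b S2 \ removedV a b S2

/-- The support of a grading. -/
def suppH (a : ℕ) (S1 : Fin a → ℕ) : Finset (Fin a) := Finset.univ.filter fun h => S1 h ≠ 0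
def suppV (b : ℕ) (S2 : Fin b → ℕ) : Finset (Fin b) := Finset.univ.filter fun v => S2 v ≠ 0

/-- `d` is the oriented distance function of a cyclic arrangement of `N` points. -/
structure IsCyclicDist {E : Type*} (N : ℕ) (d : E → E → ℕ) : Prop where
  lt : ∀ e f, d e f < N
  eq_of_dist_zero : ∀ e f, d e f = 0 → e = f
  add : ∀ e g f, d e g + d g f = d e f ∨ d e g + d g f = d e f + N
  exists_dist_eq : ∀ e k, k < N → ∃ f, d e f = k

/-- The sum of `w` over the first `k` points starting at `e`. -/
def prefixSum {E : Type*} [Fintype E] (d : E → E → ℕ) (w : E → ℤ) (e : E) (k : ℕ) : ℤ :=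
  ∑ g ∈ Finset.univ.filter (fun g => d e g < k), w g

/-- The points of the shortest nonempty initial segment starting at `e` along which `w` sums to
zero (all points if there is none). -/
def zeroSegment {E : Type*} [Fintype E] (d : E → E → ℕ) (w : E → ℤ) (e : E) : Set E :=
  {x | ∀ f, prefixSum d w e (d e f + 1) = 0 → d e x ≤ d e f}

namespace IsCyclicDist

variable {E : Type*} {N : ℕ} {d : E → E → ℕ}

theorem self (hd : IsCyclicDist N d) (e : E) : d e e = 0 := by
  have := hd.add e e e
  have := hd.lt e e
  omega

theorem swap (hd : IsCyclicDist N d) : IsCyclicDist N (fun e f => d f e) where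
  lt e f := hd.lt f e
  eq_of_dist_zero e f h := (hd.eq_of_dist_zero f e h).symm
  add e g f := by
    have := hd.add f g e
    omega
  exists_dist_eq f k hk := by
    rcases Nat.eq_zero_or_pos k with rfl | hk0
    · exact ⟨f, hd.self f⟩
    · obtain ⟨e, he⟩ := hd.exists_dist_eq f (N - k) (by omega)
      have h1 := hd.add f e f
      have h2 := hd.self f
      have h3 := hd.lt e f
      exact ⟨e, by omega⟩

variable [Fintype E] {w : E → ℤ}

theorem prefixSum_add (hd : IsCyclicDist N d) (e e' : E) (m : ℕ) (hm : d e e' + m ≤ N) :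
    prefixSum d w e (d e e' + m) = prefixSum d w e (d e e') + prefixSum d w e' m := by
  unfold prefixSum
  rw [← Finset.sum_union]
  · congr 1
    ext g
    simp only [Finset.mem_union, Finset.mem_filter, Finset.mem_univ, true_and]
    have h1 := hd.add e e' g
    have h2 := hd.lt e g
    have h3 := hd.lt e' g
    omega
  · rw [Finset.disjoint_left]
    intro g
    simp only [Finset.mem_filter, Finset.mem_univ, true_and]
    have h1 := hd.add e e' g
    omega

theorem prefixSum_one (hd : IsCyclicDist N d) (e : E) : prefixSum d w e 1 = w e := by
  have h : Finset.univ.filter (fun g => d e g < 1) = {e} := by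
    ext g
    simp only [Finset.mem_filter, Finset.mem_univ, true_and, Finset.mem_singleton]
    constructor
    · intro h
      exact (hd.eq_of_dist_zero e g (by omega)).symm
    · rintro rfl
      simp [hd.self]
  rw [prefixSum, h, Finset.sum_singleton]

theorem exists_prefixSum_eq_zero (hd : IsCyclicDist N d) (hw : ∀ g, -1 ≤ w g) (e : E)
    (he : 0 ≤ w e) (m : ℕ) (hm : m < N) (hneg : prefixSum d w e (m + 1) ≤ 0) :
    ∃ f, d e f ≤ m ∧ prefixSum d w e (d e f + 1) = 0 := by
  induction m with
  | zero =>
    refine ⟨e, (hd.self e).le, ?_⟩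
    rw [hd.self]
    have := hd.prefixSum_one (w := w) e
    rw [zero_add] at hneg ⊢
    omega
  | succ m ih =>
    by_cases h : prefixSum d w e (m + 1) ≤ 0
    · obtain ⟨f, hf, hf0⟩ := ih (by omega) h
      exact ⟨f, by omega, hf0⟩
    · obtain ⟨f, hf⟩ := hd.exists_dist_eq e (m + 1) hm
      have h1 := hd.prefixSum_add (w := w) e f 1 (by omega)
      rw [hd.prefixSum_one] at h1
      have h2 := hw f
      refine ⟨f, hf.le, ?_⟩
      rw [hf] at h1 ⊢
      omega

theorem zeroSegment_subset (hd : IsCyclicDist N d) (hw : ∀ g, -1 ≤ w g) {e e' f : E}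
    (he : 0 ≤ w e) (he' : 0 ≤ w e') (hf : prefixSum d w e (d e f + 1) = 0)
    (hmin : f ∈ zeroSegment d w e) (hle : d e e' ≤ d e f) :
    zeroSegment d w e' ⊆ zeroSegment d w e := by
  rcases Nat.eq_zero_or_pos (d e e') with h0 | hpos
  · rw [hd.eq_of_dist_zero e e' h0]
  have hlt := hd.lt e f
  have hpre : 0 < prefixSum d w e (d e e') := by
    by_contra hcon
    obtain ⟨g, hg, hg0⟩ := hd.exists_prefixSum_eq_zero hw e he (d e e' - 1) (by omega)
      (by rw [Nat.sub_add_cancel hpos]; omega)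
    have := hmin g hg0
    omega
  have hsplit := hd.prefixSum_add (w := w) e e' (d e f - d e e' + 1) (by omega)
  rw [show d e e' + (d e f - d e e' + 1) = d e f + 1 by omega] at hsplit
  obtain ⟨g, hg, hg0⟩ := hd.exists_prefixSum_eq_zero hw e' he' (d e f - d e e') (by omega)
    (by omega)
  intro x hx k hk
  have h1 := hx g hg0
  have h2 := hmin k hk
  have h3 := hd.add e e' x
  omega

theorem exists_last (e : E) (h : ∃ f, prefixSum d w e (d e f + 1) = 0) :
    ∃ f, prefixSum d w e (d e f + 1) = 0 ∧ f ∈ zeroSegment d w e := by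
  obtain ⟨f, hf, hmin⟩ := Finset.exists_min_image
    (Finset.univ.filter fun f => prefixSum d w e (d e f + 1) = 0) (d e)
    (by obtain ⟨f, hf⟩ := h; exact ⟨f, by simpa using hf⟩)
  simp only [Finset.mem_filter, Finset.mem_univ, true_and] at hf hmin
  exact ⟨f, hf, hmin⟩

theorem zeroSegment_nested_or_disjoint (hd : IsCyclicDist N d) (hw : ∀ g, -1 ≤ w g) {e e' : E}
    (he : 0 ≤ w e) (he' : 0 ≤ w e') :
    Disjoint (zeroSegment d w e) (zeroSegment d w e') ∨
      zeroSegment d w e ⊆ zeroSegment d w e' ∨ zeroSegment d w e' ⊆ zeroSegment d w e := by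
  by_cases h : ∃ f, prefixSum d w e (d e f + 1) = 0
  swap
  · exact .inr (.inr fun x _ f hf => (h ⟨f, hf⟩).elim)
  by_cases h' : ∃ f, prefixSum d w e' (d e' f + 1) = 0
  swap
  · exact .inr (.inl fun x _ f hf => (h' ⟨f, hf⟩).elim)
  obtain ⟨f, hf, hmin⟩ := exists_last e h
  obtain ⟨f', hf', hmin'⟩ := exists_last e' h'
  by_cases hle : d e e' ≤ d e f
  · exact .inr (.inr (hd.zeroSegment_subset hw he he' hf hmin hle))
  by_cases hle' : d e' e ≤ d e' f'
  · exact .inr (.inl (hd.zeroSegment_subset hw he' he hf' hmin' hle'))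
  refine .inl (Set.disjoint_left.2 fun x hx hx' => ?_)
  have h1 := hx f hf
  have h2 := hx' f' hf'
  have h3 := hd.add e e' x
  have h4 := hd.add e e' e
  have h5 := hd.self e
  omega

end IsCyclicDist

theorem pos_lt (a b : ℕ) (e : Edge a b) : pos a b e < a + b := by
  rcases e with ⟨j, hj⟩ | ⟨i, hi⟩
  · have : j * b / a ≤ b := Nat.div_le_of_le_mul (Nat.mul_le_mul_right b hj.le)
    simp only [pos, ht]
    omega
  · have : ((i + 1) * a + b - 1) / b ≤ a := by
      rw [← Nat.lt_succ_iff, Nat.div_lt_iff_lt_mul (by omega)]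
      have : (i + 1) * a ≤ b * a := Nat.mul_le_mul_right a hi
      rw [Nat.succ_mul a b, mul_comm a b]
      omega
    simp only [pos, dep]
    omega

theorem pos_inl_ne_pos_inr (a b : ℕ) (j : Fin a) (i : Fin b) :
    pos a b (.inl j) ≠ pos a b (.inr i) := by
  obtain ⟨j, hj⟩ := j
  obtain ⟨i, hi⟩ := i
  simp only [pos, ht, dep]
  have h1 : i + 1 ≤ j * b / a ↔ (i + 1) * a ≤ j * b := Nat.le_div_iff_mul_le (by omega)
  have h2 : ((i + 1) * a + b - 1) / b < j + 1 ↔ (i + 1) * a + b - 1 < (j + 1) * b :=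
    Nat.div_lt_iff_lt_mul (by omega)
  rw [Nat.succ_mul j b] at h2
  omega

theorem pos_injective (a b : ℕ) : Function.Injective (pos a b) := by
  have hl : StrictMono fun j : Fin a => pos a b (.inl j) := fun j k h =>
    Nat.add_lt_add_of_lt_of_le h
      (Nat.div_le_div_right (Nat.mul_le_mul_right b (Fin.lt_def.1 h).le))
  have hr : StrictMono fun i : Fin b => pos a b (.inr i) := fun i k h => by
    refine Nat.add_lt_add_of_lt_of_le h (Nat.div_le_div_right ?_)
    have : (i.1 + 1) * a ≤ (k.1 + 1) * a :=
      Nat.mul_le_mul_right a (Nat.succ_le_succ (Fin.lt_def.1 h).le)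
    omega
  rintro (j | i) (k | l) h
  · rw [hl.injective h]
  · exact (pos_inl_ne_pos_inr a b j l h).elim
  · exact (pos_inl_ne_pos_inr a b k i h.symm).elim
  · rw [hr.injective h]

theorem dd_eq (a b : ℕ) (e f : Edge a b) :
    dd a b e f = if pos a b e ≤ pos a b f then pos a b f - pos a b e
      else pos a b f + (a + b) - pos a b e := by
  have he := pos_lt a b e
  have hf := pos_lt a b f
  unfold dd
  split_ifs with h
  · rw [show pos a b f + (a + b) - pos a b e = pos a b f - pos a b e + (a + b) by omega,
      Nat.add_mod_right, Nat.mod_eq_of_lt (by omega)]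
  · exact Nat.mod_eq_of_lt (by omega)

theorem isCyclicDist_dd (a b : ℕ) : IsCyclicDist (a + b) (dd a b) := by
  have hlt (e f : Edge a b) : dd a b e f < a + b :=
    Nat.mod_lt _ (Nat.zero_lt_of_lt (pos_lt a b e))
  have hadd (e g f : Edge a b) : dd a b e g + dd a b g f = dd a b e f ∨
      dd a b e g + dd a b g f = dd a b e f + (a + b) := by
    have he := pos_lt a b e
    have hf := pos_lt a b f
    have hg := pos_lt a b g
    simp only [dd_eq]
    split_ifs <;> omega
  have hzero (e f : Edge a b) (h : dd a b e f = 0) : e = f := by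
    have he := pos_lt a b e
    rw [dd_eq] at h
    refine pos_injective a b ?_
    split_ifs at h <;> omega
  refine ⟨hlt, hzero, hadd, fun e k hk => ?_⟩
  have hinj : Function.Injective fun f => (⟨dd a b e f, hlt e f⟩ : Fin (a + b)) := by
    intro f g hfg
    have h1 : dd a b e f = dd a b e g := congrArg Fin.val hfg
    have h2 := hadd e f g
    have h3 := hlt f g
    exact hzero f g (by omega)
  have hbij := (Fintype.bijective_iff_injective_and_card _).2 ⟨hinj, by simp⟩
  obtain ⟨f, hf⟩ := hbij.2 ⟨k, hk⟩
  exact ⟨f, congrArg Fin.val hf⟩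

/-- The edge weights whose sum over a set of edges is `fH`. -/
def weightH {a b : ℕ} (S1 : Fin a → ℕ) : Edge a b → ℤ := Sum.elim (fun j => S1 j) fun _ => -1

/-- The edge weights whose sum over a set of edges is `fV`. -/
def weightV {a b : ℕ} (S2 : Fin b → ℕ) : Edge a b → ℤ := Sum.elim (fun _ => -1) fun i => S2 i

theorem sum_weightH (a b : ℕ) (S1 : Fin a → ℕ) (s : Finset (Edge a b)) :
    ∑ e ∈ s, weightH S1 e = fH a b S1 s := by
  rw [fH, hsum, vcount, Finset.card_filter]
  push_cast
  rw [← Finset.sum_sub_distrib]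
  refine Finset.sum_congr rfl fun e _ => ?_
  cases e <;> simp [weightH]

theorem sum_weightV (a b : ℕ) (S2 : Fin b → ℕ) (s : Finset (Edge a b)) :
    ∑ e ∈ s, weightV S2 e = fV a b S2 s := by
  rw [fV, vsum, hcount, Finset.card_filter]
  push_cast
  rw [← Finset.sum_sub_distrib]
  refine Finset.sum_congr rfl fun e _ => ?_
  cases e <;> simp [weightV]

theorem balH_iff (a b : ℕ) (S1 : Fin a → ℕ) (h : Fin a) (e : Edge a b) :
    balH a b S1 h e ↔
      prefixSum (dd a b) (weightH S1) (.inl h) (dd a b (.inl h) e + 1) = 0 := by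
  simp only [prefixSum, Nat.lt_succ_iff]
  change _ ↔ ∑ g ∈ subpath a b (.inl h) e, weightH S1 g = 0
  rw [sum_weightH, fH, balH]
  omega

theorem subpath_eq_filter_dd_right (a b : ℕ) (e f : Edge a b) :
    subpath a b e f = Finset.univ.filter fun g => dd a b g f ≤ dd a b e f := by
  ext g
  simp only [subpath, Finset.mem_filter, Finset.mem_univ, true_and]
  have h1 := (isCyclicDist_dd a b).add e g f
  have h2 := (isCyclicDist_dd a b).lt e g
  have h3 := (isCyclicDist_dd a b).lt g f
  omega

theorem balV_iff (a b : ℕ) (S2 : Fin b → ℕ) (e : Edge a b) (v : Fin b) :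
    balV a b S2 e v ↔
      prefixSum (fun e f => dd a b f e) (weightV S2) (.inr v) (dd a b e (.inr v) + 1) = 0 := by
  simp only [prefixSum, Nat.lt_succ_iff]
  rw [← subpath_eq_filter_dd_right, sum_weightV, fV, balV]
  omega

theorem mem_shH_iff (a b : ℕ) (S1 : Fin a → ℕ) (h : Fin a) (v : Fin b) :
    v ∈ shH a b S1 h ↔ .inr v ∈ zeroSegment (dd a b) (weightH S1) (.inl h) := by
  simp [shH, zeroSegment, balH_iff]

theorem mem_shV_iff (a b : ℕ) (S2 : Fin b → ℕ) (v : Fin b) (h : Fin a) :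
    h ∈ shV a b S2 v ↔
      .inl h ∈ zeroSegment (fun e f => dd a b f e) (weightV S2) (.inr v) := by
  simp [shV, zeroSegment, balV_iff]

/-- **Local shadows are nested or disjoint.** -/
theorem local_shadows_nested_or_disjoint (a1 a2 : ℕ) :
    (∀ (S1 : Fin a1 → ℕ) (h h' : Fin a1),
      shH a1 a2 S1 h ∩ shH a1 a2 S1 h' = ∅ ∨
      shH a1 a2 S1 h ⊆ shH a1 a2 S1 h' ∨ shH a1 a2 S1 h' ⊆ shH a1 a2 S1 h) ∧
    (∀ (S2 : Fin a2 → ℕ) (v v' : Fin a2),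
      shV a1 a2 S2 v ∩ shV a1 a2 S2 v' = ∅ ∨
      shV a1 a2 S2 v ⊆ shV a1 a2 S2 v' ∨ shV a1 a2 S2 v' ⊆ shV a1 a2 S2 v) := by
  constructor
  · intro S1 h h'
    have hw (g : Edge a1 a2) : -1 ≤ weightH S1 g := by
      cases g <;> simp only [weightH, Sum.elim_inl, Sum.elim_inr] <;> omega
    rcases (isCyclicDist_dd a1 a2).zeroSegment_nested_or_disjoint hw
      (e := .inl h) (e' := .inl h') (by simp [weightH]) (by simp [weightH]) with H | H | H
    · left
      rw [← Finset.disjoint_iff_inter_eq_empty, Finset.disjoint_left]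
      intro v hv hv'
      rw [mem_shH_iff] at hv hv'
      exact Set.disjoint_left.1 H hv hv'
    · right; left
      intro v hv
      rw [mem_shH_iff] at hv ⊢
      exact H hv
    · right; right
      intro v hv
      rw [mem_shH_iff] at hv ⊢
      exact H hv
  · intro S2 v v'
    have hw (g : Edge a1 a2) : -1 ≤ weightV S2 g := by
      cases g <;> simp only [weightV, Sum.elim_inl, Sum.elim_inr] <;> omega
    rcases (isCyclicDist_dd a1 a2).swap.zeroSegment_nested_or_disjoint hw
      (e := .inr v) (e' := .inr v') (by simp [weightV]) (by simp [weightV]) with H | H | H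
    · left
      rw [← Finset.disjoint_iff_inter_eq_empty, Finset.disjoint_left]
      intro h hh hh'
      rw [mem_shV_iff] at hh hh'
      exact Set.disjoint_left.1 H hh hh'
    · right; left
      intro h hh
      rw [mem_shV_iff] at hh ⊢
      exact H hh
    · right; right
      intro h hh
      rw [mem_shV_iff] at hh ⊢
      exact H hh

end Dyck
end
end
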